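/- arXiv:1807.04613 — 3 statements merged into one kernel-verified Lean document; each statement's English description precedes it below -/
import Mathlib

section
/- For every request sequence σ and every algorithm ALG serving σ on a self-adjusting complete binary tree (paying access cost equal to the requested item's depth plus unit cost per swap), the total cost satisfies cost(ALG(σ)) ≥ WS(σ)/4, where WS(σ) = ∑_{t=1}^m log₂(rank of σ^(t) at time t) is the working set bound of σ. -/
/-!
Model: `n` items (elements of `Fin n`) are stored, one per server, on the `n`
servers of a fixed complete binary tree.  Servers are indexed in heap order by
`Fin n` (server `s` has heap index `s + 1`); the root (index `0`) has depth `0`.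
A configuration is a bijection `Fin n ≃ Fin n` from items to servers; the depth
of an item is the depth of its hosting server.
-/

/-- Depth of the server with 0-based heap index `s` in the complete binary tree
(the root, index `0`, has depth `0`). -/
def sDepth {n : ℕ} (s : Fin n) : ℕ := Nat.log 2 (s.val + 1)

/-- The parent server of `s` in the complete binary tree (the root is its own parent). -/
def sParent {n : ℕ} (s : Fin n) : Fin n :=
  ⟨(s.val + 1) / 2 - 1, by
    have h := Nat.div_le_self (s.val + 1) 2
    have h2 := s.isLt
    omega⟩

/-- Apply a list of swaps to a configuration (a bijection from items to servers):
each swap exchanges the item at the given server with the item at its parent server,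
at unit cost per swap. -/
def applySwaps {n : ℕ} (l : List (Fin n)) (c : Fin n ≃ Fin n) : Fin n ≃ Fin n :=
  l.foldl (fun c s => c.trans (Equiv.swap s (sParent s))) c

/-- The rank of item `v` at time `t` (the number of distinct items requested since the
last request to `v` prior to `t`, including `v`): upon a request to an item its rank
becomes `1`, the ranks of items with smaller rank increase by one, and all other ranks
are unchanged.  Initially the ranks are induced by the bijection `r0`
(`itemRank r0 σ 0 v = r0 v + 1`, a permutation of `1, …, n`). -/
def itemRank {n : ℕ} (r0 : Fin n ≃ Fin n) (σ : ℕ → Fin n) : ℕ → Fin n → ℕ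
  | 0 => fun v => (r0 v).val + 1
  | t + 1 => fun v =>
      if v = σ t then 1
      else if itemRank r0 σ t v < itemRank r0 σ t (σ t) then itemRank r0 σ t v + 1
      else itemRank r0 σ t v

open Finset

/-- The number of items that are ranked ahead of `v` but stored strictly deeper than `v`. -/
def rankInversions {n : ℕ} (L R : Fin n → ℕ) (v : Fin n) : ℕ :=
  #{w | R w < R v ∧ L v < L w}

/-- The contribution of the item `v` to the potential function. -/
noncomputable def itemPotential {n : ℕ} (L R : Fin n → ℕ) (v : Fin n) : ℝ :=
  Real.logb 2 (1 + (rankInversions L R v : ℝ) / 2 ^ L v)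

/-- The update of ranks `R` upon a request to `a`. -/
def rankUpdate {n : ℕ} (R : Fin n → ℕ) (a v : Fin n) : ℕ :=
  if v = a then 1 else if R v < R a then R v + 1 else R v

lemma itemPotential_nonneg {n : ℕ} (L R : Fin n → ℕ) (v : Fin n) :
    0 ≤ itemPotential L R v := by
  apply Real.logb_nonneg one_lt_two
  have : (0 : ℝ) ≤ (rankInversions L R v : ℝ) / 2 ^ L v := by positivity
  linarith

lemma logb_two_add_le {a b : ℝ} (ha : 1 ≤ a) (hb : 0 ≤ b) :
    Real.logb 2 (a + b) ≤ Real.logb 2 a + 3 / 2 * b := by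
  have h2 : (2 / 3 : ℝ) < Real.log 2 := by linarith [Real.log_two_gt_d9]
  have hpos : 0 < a := by linarith
  have h : Real.log (a + b) ≤ Real.log a + b := by
    have e : a + b = a * (1 + b / a) := by field_simp
    have hba : b / a ≤ b := div_le_self hb ha
    have hba' : 0 ≤ b / a := by positivity
    rw [e, Real.log_mul (by positivity) (by positivity)]
    linarith [Real.log_le_sub_one_of_pos (show 0 < 1 + b / a by positivity)]
  unfold Real.logb
  calc Real.log (a + b) / Real.log 2 ≤ (Real.log a + b) / Real.log 2 := by gcongr
    _ = Real.log a / Real.log 2 + b / Real.log 2 := add_div _ _ _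
    _ ≤ Real.log a / Real.log 2 + 3 / 2 * b := by
      gcongr
      rw [div_le_iff₀ (by linarith)]
      nlinarith

lemma itemPotential_mono {n : ℕ} {L R L' R' : Fin n → ℕ} {v : Fin n} (hL : L v ≤ L' v)
    (h : rankInversions L' R' v ≤ rankInversions L R v) :
    itemPotential L' R' v ≤ itemPotential L R v := by
  unfold itemPotential
  apply Real.logb_le_logb_of_le one_lt_two (by positivity)
  gcongr
  norm_num

lemma itemPotential_le_of_succ {n : ℕ} {L R L' R' : Fin n → ℕ} {v : Fin n} (hL : L' v = L v)
    (h : rankInversions L' R' v ≤ rankInversions L R v + 1) :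
    itemPotential L' R' v ≤ itemPotential L R v + 3 / 2 * (1 / 2 ^ L v) := by
  unfold itemPotential
  have hd : (0 : ℝ) ≤ (rankInversions L R v : ℝ) / 2 ^ L v := by positivity
  refine le_trans ?_ (logb_two_add_le (by linarith) (by positivity))
  apply Real.logb_le_logb_of_le one_lt_two (by positivity)
  rw [hL, add_assoc, ← add_div]
  gcongr
  exact_mod_cast h

lemma card_sDepth_eq_le {n : ℕ} (c : Fin n ≃ Fin n) (j : ℕ) :
    #{v | sDepth (c v) = j} ≤ 2 ^ j := by
  calc #{v | sDepth (c v) = j} ≤ #(Ico (2 ^ j) (2 ^ (j + 1))) := by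
        apply card_le_card_of_injOn (fun v => (c v).val + 1)
        · intro v hv
          replace hv : Nat.log 2 ((c v).val + 1) = j := (mem_filter.1 hv).2
          simp only [coe_Ico, Set.mem_Ico]
          exact (Nat.log_eq_iff (Or.inr ⟨by norm_num, by omega⟩)).1 hv
        · intro u _ v _ h
          apply c.injective
          apply Fin.ext
          simpa using h
    _ = 2 ^ j := by rw [Nat.card_Ico, pow_succ]; omega

lemma card_sDepth_le {n : ℕ} (c : Fin n ≃ Fin n) (d : ℕ) :
    #{v | sDepth (c v) ≤ d} + 1 ≤ 2 ^ (d + 1) := by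
  have h : #{v | sDepth (c v) ≤ d} ≤ #(Ico 1 (2 ^ (d + 1))) := by
    apply card_le_card_of_injOn (fun v => (c v).val + 1)
    · intro v hv
      replace hv : Nat.log 2 ((c v).val + 1) ≤ d := (mem_filter.1 hv).2
      simp only [coe_Ico, Set.mem_Ico]
      exact ⟨by omega, Nat.lt_pow_of_log_lt (by norm_num) (by omega)⟩
    · intro u _ v _ h
      apply c.injective
      apply Fin.ext
      simpa using h
  rw [Nat.card_Ico] at h
  have := Nat.one_le_two_pow (n := d + 1)
  omega

lemma sum_sDepth_eq_le {n : ℕ} (c : Fin n ≃ Fin n) (j : ℕ) :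
    ∑ v with sDepth (c v) = j, (1 : ℝ) / 2 ^ sDepth (c v) ≤ 1 := by
  rw [sum_congr rfl (g := fun _ => (1 : ℝ) / 2 ^ j) (by
    intro v hv
    rw [(mem_filter.1 hv).2]), sum_const, nsmul_eq_mul, mul_one_div, div_le_one (by positivity)]
  exact_mod_cast card_sDepth_eq_le c j

lemma sum_sDepth_lt_le {n : ℕ} (c : Fin n ≃ Fin n) (d : ℕ) :
    ∑ v with sDepth (c v) < d, (1 : ℝ) / 2 ^ sDepth (c v) ≤ d := by
  rw [← sum_fiberwise_of_maps_to (t := range d) (g := fun v => sDepth (c v)) (by simp)]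
  calc _ ≤ ∑ j ∈ range d, (1 : ℝ) := by
        apply sum_le_sum
        intro j _
        refine le_trans (sum_le_sum_of_subset_of_nonneg ?_ ?_) (sum_sDepth_eq_le c j)
        · intro v
          simp
        · intros
          positivity
    _ = d := by simp

lemma rankUpdate_injective {n : ℕ} {R : Fin n → ℕ} (hR : R.Injective)
    (hR1 : ∀ v, 1 ≤ R v) (a : Fin n) : (rankUpdate R a).Injective := by
  intro u v h
  unfold rankUpdate at h
  have hu := hR1 u
  have hv := hR1 v
  have ha : u ≠ a → R u ≠ R a := fun h => hR.ne h
  have hb : v ≠ a → R v ≠ R a := fun h => hR.ne h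
  by_contra huv
  have := hR.ne huv
  split_ifs at h <;> grind

lemma itemRank_spec {n : ℕ} (r0 : Fin n ≃ Fin n) (σ : ℕ → Fin n) (t : ℕ) :
    (itemRank r0 σ t).Injective ∧ ∀ v, 1 ≤ itemRank r0 σ t v ∧ itemRank r0 σ t v ≤ n := by
  induction t with
  | zero =>
    refine ⟨fun u v h => r0.injective (Fin.ext (by simpa [itemRank] using h)), fun v => ?_⟩
    simp only [itemRank]
    omega
  | succ t ih =>
    refine ⟨rankUpdate_injective ih.1 (fun v => (ih.2 v).1) (σ t), fun v => ?_⟩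
    have h1 := ih.2 v
    have h2 := ih.2 (σ t)
    simp only [itemRank]
    split_ifs <;> omega

lemma card_rank_lt {n : ℕ} {R : Fin n → ℕ} (hR : R.Injective)
    (hR1 : ∀ v, 1 ≤ R v ∧ R v ≤ n) (a : Fin n) : R a ≤ #{w | R w < R a} + 1 := by
  have himg : univ.image R = Icc 1 n := by
    apply eq_of_subset_of_card_le
    · intro k hk
      obtain ⟨v, -, rfl⟩ := mem_image.1 hk
      exact mem_Icc.2 (hR1 v)
    · rw [card_image_of_injective _ hR]
      simp
  have hsub : Ico 1 (R a) ⊆ image R {w | R w < R a} := by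
    intro k hk
    rw [mem_Ico] at hk
    have hk' : k ∈ univ.image R := by
      rw [himg, mem_Icc]
      have := (hR1 a).2
      omega
    obtain ⟨v, -, rfl⟩ := mem_image.1 hk'
    exact mem_image.2 ⟨v, by simp [hk.2], rfl⟩
  have h := (card_le_card hsub).trans card_image_le
  rw [Nat.card_Ico] at h
  omega

lemma rank_le_rankInversions {n : ℕ} (c : Fin n ≃ Fin n) {R : Fin n → ℕ} (hR : R.Injective)
    (hR1 : ∀ v, 1 ≤ R v ∧ R v ≤ n) (a : Fin n) :
    R a + 1 ≤ rankInversions (fun v => sDepth (c v)) R a + 2 ^ (sDepth (c a) + 1) := by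
  have h1 := card_rank_lt hR hR1 a
  have h2 := card_sDepth_le c (sDepth (c a))
  have h3 : ({w | R w < R a} : Finset (Fin n)) ⊆
      ({w | R w < R a ∧ sDepth (c a) < sDepth (c w)} : Finset (Fin n)) ∪
        ({w | sDepth (c w) ≤ sDepth (c a)} : Finset (Fin n)).erase a := by
    intro w
    simp only [mem_filter, mem_univ, true_and, mem_union, mem_erase]
    intro hw
    have : w ≠ a := by
      rintro rfl
      exact lt_irrefl _ hw
    grind
  have h4 := (card_le_card h3).trans (card_union_le _ _)
  rw [card_erase_of_mem (by simp)] at h4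
  have h5 : 0 < #{w | sDepth (c w) ≤ sDepth (c a)} := card_pos.2 ⟨a, by simp⟩
  change R a + 1 ≤ #{w | R w < R a ∧ sDepth (c a) < sDepth (c w)} + _
  omega

lemma logb_rank_le {n : ℕ} (c : Fin n ≃ Fin n) {R : Fin n → ℕ} (hR : R.Injective)
    (hR1 : ∀ v, 1 ≤ R v ∧ R v ≤ n) (a : Fin n) :
    Real.logb 2 (R a) ≤ itemPotential (fun v => sDepth (c v)) R a + 2 * sDepth (c a) := by
  have h := rank_le_rankInversions c hR hR1 a
  have hpos : (0 : ℝ) < R a := by exact_mod_cast (hR1 a).1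
  unfold itemPotential
  set i := rankInversions (fun v => sDepth (c v)) R a
  set d := sDepth (c a)
  rw [show (2 * d : ℝ) = Real.logb 2 (2 ^ (2 * d)) by
    rw [Real.logb_pow, Real.logb_self_eq_one one_lt_two]; push_cast; ring,
    ← Real.logb_mul (by positivity) (by positivity)]
  apply Real.logb_le_logb_of_le one_lt_two hpos
  have h' : (R a : ℝ) + 1 ≤ i + 2 * 2 ^ d := by
    rw [pow_succ] at h
    have : R a + 1 ≤ i + 2 * 2 ^ d := by omega
    exact_mod_cast this
  have hp : (1 : ℝ) ≤ 2 ^ d := one_le_pow₀ (by norm_num)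
  have hi : (0 : ℝ) ≤ i := by positivity
  have e : (1 + (i : ℝ) / 2 ^ d) * 2 ^ (2 * d) = 2 ^ d * 2 ^ d + i * 2 ^ d := by
    rw [two_mul, pow_add]
    field_simp
  rw [e]
  nlinarith [sq_nonneg ((2 : ℝ) ^ d - 1), mul_nonneg hi (sub_nonneg.2 hp)]

lemma sum_itemPotential_access {n : ℕ} (c : Fin n ≃ Fin n) {R : Fin n → ℕ} (hR : R.Injective)
    (hR1 : ∀ v, 1 ≤ R v ∧ R v ≤ n) (a : Fin n) :
    ∑ v, itemPotential (fun v => sDepth (c v)) (rankUpdate R a) v + Real.logb 2 (R a) ≤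
      ∑ v, itemPotential (fun v => sDepth (c v)) R v + 4 * sDepth (c a) := by
  set L : Fin n → ℕ := fun v => sDepth (c v) with hL
  have hlog : Real.logb 2 (R a) ≤ itemPotential L R a + 2 * L a := logb_rank_le c hR hR1 a
  have hsum : ∑ v with L v < L a, (1 : ℝ) / 2 ^ L v ≤ L a := sum_sDepth_lt_le c (L a)
  have ha : itemPotential L (rankUpdate R a) a = 0 := by
    have : rankInversions L (rankUpdate R a) a = 0 := by
      rw [rankInversions, card_eq_zero, filter_eq_empty_iff]
      intro w _
      have := (hR1 w).1
      unfold rankUpdate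
      split_ifs <;> omega
    simp [itemPotential, this]
  have key : ∀ v, v ≠ a → itemPotential L (rankUpdate R a) v ≤
      itemPotential L R v + if L v < L a then 3 / 2 * (1 / 2 ^ L v : ℝ) else 0 := by
    intro v hv
    split_ifs with hlt
    · apply itemPotential_le_of_succ rfl
      refine (card_le_card ?_).trans (card_insert_le a _)
      intro w
      simp only [mem_filter, mem_univ, true_and, mem_insert, rankUpdate]
      split_ifs <;> grind
    · rw [add_zero]
      apply itemPotential_mono le_rfl
      apply card_le_card
      intro w
      simp only [mem_filter, mem_univ, true_and, rankUpdate]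
      split_ifs <;> grind
  have tot : ∑ v, itemPotential L (rankUpdate R a) v ≤
      ∑ v, ((itemPotential L R v + if L v < L a then 3 / 2 * (1 / 2 ^ L v : ℝ) else 0) -
        if v = a then itemPotential L R a else 0) := by
    apply sum_le_sum
    intro v _
    by_cases hv : v = a
    · subst hv
      simp [ha]
    · simpa [hv] using key v hv
  rw [sum_sub_distrib, sum_add_distrib, sum_ite_eq' univ a, if_pos (mem_univ a), ← sum_filter,
    ← mul_sum] at tot
  change _ ≤ _ + 4 * (L a : ℝ)
  have hd : (0 : ℝ) ≤ L a := by positivity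
  linarith

lemma sDepth_eq_sParent_add_one {n : ℕ} {s : Fin n} (h : sParent s ≠ s) :
    sDepth s = sDepth (sParent s) + 1 := by
  have hs : s.val ≠ 0 := by
    intro h0
    apply h
    apply Fin.ext
    simp [sParent, h0]
  have : (s.val + 1) / 2 - 1 + 1 = (s.val + 1) / 2 := by omega
  simp only [sDepth, sParent, this]
  exact Nat.log_of_one_lt_of_le (by norm_num) (by omega)

lemma sum_itemPotential_swap {n : ℕ} (c : Fin n ≃ Fin n) (R : Fin n → ℕ) (s : Fin n) :
    ∑ v, itemPotential (fun v => sDepth ((c.trans (Equiv.swap s (sParent s))) v)) R v ≤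
      ∑ v, itemPotential (fun v => sDepth (c v)) R v + 4 := by
  by_cases hs : sParent s = s
  · simp [hs]
  have hdep := sDepth_eq_sParent_add_one hs
  set c' := c.trans (Equiv.swap s (sParent s)) with hc'
  obtain ⟨x, hx⟩ := c.surjective s
  obtain ⟨y, hy⟩ := c.surjective (sParent s)
  have hxy : x ≠ y := by
    rintro rfl
    exact hs (hy.symm.trans hx)
  set L : Fin n → ℕ := fun v => sDepth (c v) with hL
  set L' : Fin n → ℕ := fun v => sDepth (c' v) with hL'
  have hx' : L' x = L y := by simp [hL, hL', hc', hx, hy]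
  have hy' : L' y = L x := by simp [hL, hL', hc', hx, hy]
  have hne : ∀ v, v ≠ x → v ≠ y → L' v = L v := by
    intro v h1 h2
    simp only [hL, hL', hc', Equiv.trans_apply]
    rw [Equiv.swap_apply_of_ne_of_ne]
    · rw [← hx]; exact c.injective.ne h1
    · rw [← hy]; exact c.injective.ne h2
  have hxd : L x = L y + 1 := by simp only [hL, hx, hy, hdep]
  clear_value L'
  have hsum : ∑ v with L v = L y, (1 : ℝ) / 2 ^ L v ≤ 1 := sum_sDepth_eq_le c (L y)
  have hcard : #{w | L' w = L y + 1} ≤ 2 ^ (L y + 1) := by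
    rw [hL']
    exact card_sDepth_eq_le c' _
  have hpx : itemPotential L' R x ≤ itemPotential L R x + 2 := by
    have hinv : rankInversions L' R x ≤ rankInversions L R x + 2 ^ (L y + 1) := by
      refine le_trans ?_ (Nat.add_le_add_left hcard _)
      refine (card_le_card ?_).trans (card_union_le _ _)
      intro w
      simp only [mem_filter, mem_univ, true_and, mem_union]
      grind
    unfold itemPotential
    have h4 : Real.logb 2 4 = 2 := by
      rw [show (4 : ℝ) = 2 ^ 2 by norm_num, Real.logb_pow, Real.logb_self_eq_one one_lt_two]
      norm_num
    refine le_trans ?_ (add_le_add_right h4.le _)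
    rw [← Real.logb_mul (by positivity) (by norm_num)]
    apply Real.logb_le_logb_of_le one_lt_two (by positivity)
    have hinv' : (rankInversions L' R x : ℝ) ≤ rankInversions L R x + 2 ^ (L y + 1) := by
      exact_mod_cast hinv
    rw [hx', hxd]
    calc 1 + (rankInversions L' R x : ℝ) / 2 ^ L y
        ≤ 1 + ((rankInversions L R x : ℝ) + 2 ^ (L y + 1)) / 2 ^ L y := by gcongr
      _ = 3 + 2 * ((rankInversions L R x : ℝ) / 2 ^ (L y + 1)) := by
        rw [pow_succ]
        field_simp
        ring
      _ ≤ (1 + (rankInversions L R x : ℝ) / 2 ^ (L y + 1)) * 4 := by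
        have : (0 : ℝ) ≤ (rankInversions L R x : ℝ) / 2 ^ (L y + 1) := by positivity
        linarith
  have key : ∀ v, itemPotential L' R v ≤ itemPotential L R v +
      ((if v = x then 2 else 0) + if L v = L y then 3 / 2 * (1 / 2 ^ L v : ℝ) else 0) := by
    intro v
    have hnn : (0 : ℝ) ≤ if L v = L y then 3 / 2 * (1 / 2 ^ L v : ℝ) else 0 := by
      split_ifs <;> positivity
    by_cases hvx : v = x
    · subst hvx
      rw [if_pos rfl]
      linarith
    rw [if_neg hvx, zero_add]
    by_cases hvy : v = y
    · subst hvy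
      have : itemPotential L' R v ≤ itemPotential L R v := by
        apply itemPotential_mono (by omega)
        apply card_le_card
        intro w
        simp only [mem_filter, mem_univ, true_and]
        grind
      linarith
    split_ifs with hlt
    · apply itemPotential_le_of_succ (hne v hvx hvy)
      refine (card_le_card ?_).trans (card_insert_le y _)
      intro w
      simp only [mem_filter, mem_univ, true_and, mem_insert]
      grind
    · rw [add_zero]
      apply itemPotential_mono (hne v hvx hvy).ge
      apply card_le_card
      intro w
      simp only [mem_filter, mem_univ, true_and]
      grind
  have tot := sum_le_sum (fun v (_ : v ∈ univ) => key v)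
  rw [sum_add_distrib, sum_add_distrib, sum_ite_eq' univ x, if_pos (mem_univ x), ← sum_filter,
    ← mul_sum] at tot
  linarith

lemma sum_itemPotential_applySwaps {n : ℕ} (R : Fin n → ℕ) (l : List (Fin n))
    (c : Fin n ≃ Fin n) :
    ∑ v, itemPotential (fun v => sDepth (applySwaps l c v)) R v ≤
      ∑ v, itemPotential (fun v => sDepth (c v)) R v + 4 * l.length := by
  induction l generalizing c with
  | nil => simp [applySwaps]
  | cons s l ih =>
    have h1 := ih (c.trans (Equiv.swap s (sParent s)))
    have h2 := sum_itemPotential_swap c R s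
    have h3 : applySwaps (s :: l) c = applySwaps l (c.trans (Equiv.swap s (sParent s))) := rfl
    rw [h3, List.length_cons]
    push_cast
    linarith

/-- **Working set lower bound.**
For every request sequence `σ` (of `m` requests) and every algorithm serving `σ` on a
self-adjusting complete binary tree with `n = 2^K - 1` servers — given by its sequence
of configurations `conf` and the lists of swaps `swaps t` performed when serving request
`t`, starting from an initial configuration that is an MRU tree — the total cost
(access cost `sDepth (conf t (σ t))` plus one per swap) is at least `WS(σ) / 4`,
where `WS(σ) = ∑_{t<m} log₂ (rank of σ t at time t)` is the working set bound. -/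
theorem working_set_lower_bound
    (K : ℕ) (hK : 1 ≤ K) (n : ℕ) (hn : n = 2 ^ K - 1)
    (r0 : Fin n ≃ Fin n) (σ : ℕ → Fin n) (m : ℕ)
    (conf : ℕ → (Fin n ≃ Fin n)) (swaps : ℕ → List (Fin n))
    (hinit : ∀ v : Fin n, sDepth (conf 0 v) = Nat.log 2 (itemRank r0 σ 0 v))
    (hstep : ∀ t, conf (t + 1) = applySwaps (swaps t) (conf t)) :
    (∑ t ∈ Finset.range m,
        ((sDepth (conf t (σ t)) : ℝ) + ((swaps t).length : ℝ)))
      ≥ (∑ t ∈ Finset.range m, Real.logb 2 (itemRank r0 σ t (σ t))) / 4 := by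
  have hzero : ∑ v, itemPotential (fun v => sDepth (conf 0 v)) (itemRank r0 σ 0) v = 0 := by
    apply sum_eq_zero
    intro v _
    have : rankInversions (fun v => sDepth (conf 0 v)) (itemRank r0 σ 0) v = 0 := by
      rw [rankInversions, card_eq_zero, filter_eq_empty_iff]
      rintro w - ⟨h1, h2⟩
      rw [hinit, hinit] at h2
      exact absurd (Nat.log_mono_right h1.le) (not_le.2 h2)
    simp [itemPotential, this]
  have hamort : ∀ k, ∑ v, itemPotential (fun v => sDepth (conf k v)) (itemRank r0 σ k) v +
      ∑ t ∈ Finset.range k, Real.logb 2 (itemRank r0 σ t (σ t)) ≤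
      4 * ∑ t ∈ Finset.range k, ((sDepth (conf t (σ t)) : ℝ) + ((swaps t).length : ℝ)) := by
    intro k
    induction k with
    | zero => simp [hzero]
    | succ k ih =>
      obtain ⟨hinj, hbd⟩ := itemRank_spec r0 σ k
      have h1 := sum_itemPotential_access (conf k) hinj hbd (σ k)
      have h2 := sum_itemPotential_applySwaps (itemRank r0 σ (k + 1)) (swaps k) (conf k)
      have h3 : itemRank r0 σ (k + 1) = rankUpdate (itemRank r0 σ k) (σ k) := rfl
      rw [sum_range_succ, sum_range_succ, hstep]
      rw [h3] at h2 ⊢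
      linarith
  have hnonneg := sum_nonneg fun v (_ : v ∈ univ) =>
    itemPotential_nonneg (fun v => sDepth (conf m v)) (itemRank r0 σ m) v
  linarith [hamort m]
end

section
/- Under the Move-Half algorithm, whenever some element v is moved down to depth h (being displaced from depth ⌊h/2⌋ as the highest-rank item at that depth by a requested item), at that time v has rank at least 2^{⌊h/2⌋}; equivalently, v's depth in an MRU tree at that time is at least ⌊h/2⌋. -/
theorem itemRank_pos {n : ℕ} (r0 : Fin n ≃ Fin n) (σ : ℕ → Fin n) (t : ℕ) (v : Fin n) :
    1 ≤ itemRank r0 σ t v := by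
  induction t with
  | zero => simp [itemRank]
  | succ t ih =>
    simp only [itemRank]
    split_ifs <;> omega

theorem itemRank_injective {n : ℕ} (r0 : Fin n ≃ Fin n) (σ : ℕ → Fin n) (t : ℕ) :
    Function.Injective (itemRank r0 σ t) := by
  induction t with
  | zero =>
    intro v w hvw
    simp only [itemRank, Nat.add_right_cancel_iff] at hvw
    exact r0.injective (Fin.ext hvw)
  | succ t ih =>
    intro v w hvw
    have hv := itemRank_pos r0 σ t v
    have hw := itemRank_pos r0 σ t w
    have hs := itemRank_pos r0 σ t (σ t)
    have hvs := @ih v (σ t)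
    have hws := @ih w (σ t)
    have hvw' := @ih v w
    simp only [itemRank] at hvw
    grind

/-- Every level `d` of a complete binary tree meeting `2 ^ (d + 1) ≤ n + 1` is full, so an upper
bound on an injective positive labelling of the items on that level is at least `2 ^ d`. -/
theorem two_pow_le_of_forall_level_le {n d m : ℕ} (hd : 2 ^ (d + 1) ≤ n + 1)
    (c : Fin n ≃ Fin n) {r : Fin n → ℕ} (hr : Function.Injective r) (hpos : ∀ x, 1 ≤ r x)
    (hm : ∀ x, sDepth (c x) = d → r x ≤ m) : 2 ^ d ≤ m := by
  have hlt (i : Fin (2 ^ d)) : 2 ^ d - 1 + i.val < n := by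
    have := i.isLt
    rw [pow_succ] at hd
    omega
  let f (i : Fin (2 ^ d)) : Fin n := c.symm ⟨2 ^ d - 1 + i.val, hlt i⟩
  have hf (i : Fin (2 ^ d)) : sDepth (c (f i)) = d := by
    have := i.isLt
    have := Nat.two_pow_pos d
    simp only [f, sDepth, Equiv.apply_symm_apply]
    apply Nat.log_eq_of_pow_le_of_lt_pow
    · omega
    · rw [pow_succ]
      omega
  have hinj : Function.Injective f := by
    intro i j hij
    have := congrArg Fin.val (c.symm.injective hij)
    exact Fin.ext (Nat.add_left_cancel this)
  have hcard : (Finset.univ : Finset (Fin (2 ^ d))).card ≤ (Finset.Icc 1 m).card :=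
    Finset.card_le_card_of_injOn (fun i => r (f i))
      (fun i _ => Finset.mem_coe.2 (Finset.mem_Icc.2 ⟨hpos _, hm _ (hf i)⟩))
      (hr.comp hinj).injOn
  simpa using hcard

/-- Under the Move-Half algorithm, whenever some element `v` is moved down to depth `h`
(being displaced, as the highest-rank item at depth `⌊h/2⌋`, by the requested item
`σ t` which is at depth `h = sDepth (conf t (σ t))`), at that time `v` has rank at
least `2 ^ ⌊h/2⌋`; equivalently, `v`'s depth in an MRU tree at that time,
`⌊log₂ (rank of v)⌋`, is at least `⌊h/2⌋`. -/
theorem movehalf_moved_down_rank_bound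
    (K : ℕ) (hK : 1 ≤ K) (n : ℕ) (hn : n = 2 ^ K - 1)
    (r0 : Fin n ≃ Fin n) (σ : ℕ → Fin n)
    (conf : ℕ → (Fin n ≃ Fin n))
    (hinit : ∀ v : Fin n, sDepth (conf 0 v) = Nat.log 2 (itemRank r0 σ 0 v))
    (hMH : ∀ t, ∃ v : Fin n,
        sDepth (conf t v) = sDepth (conf t (σ t)) / 2 ∧
        (∀ x : Fin n, sDepth (conf t x) = sDepth (conf t (σ t)) / 2 →
          itemRank r0 σ t x ≤ itemRank r0 σ t v) ∧
        conf (t + 1) = (conf t).trans (Equiv.swap (conf t (σ t)) (conf t v)))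
    (t : ℕ) (v : Fin n)
    (hdep : sDepth (conf t v) = sDepth (conf t (σ t)) / 2)
    (hmax : ∀ x : Fin n, sDepth (conf t x) = sDepth (conf t (σ t)) / 2 →
        itemRank r0 σ t x ≤ itemRank r0 σ t v) :
    2 ^ (sDepth (conf t (σ t)) / 2) ≤ itemRank r0 σ t v ∧
    sDepth (conf t (σ t)) / 2 ≤ Nat.log 2 (itemRank r0 σ t v) := by
  have key : 2 ^ (sDepth (conf t (σ t)) / 2) ≤ itemRank r0 σ t v := by
    refine two_pow_le_of_forall_level_le ?_ (conf t) (itemRank_injective r0 σ t)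
      (itemRank_pos r0 σ t) hmax
    have hK1 := Nat.two_pow_pos K
    have hlt : sDepth (conf t (σ t)) < K :=
      Nat.log_lt_of_lt_pow (by omega) (by have := (conf t (σ t)).isLt; omega)
    calc 2 ^ (sDepth (conf t (σ t)) / 2 + 1) ≤ 2 ^ K :=
          Nat.pow_le_pow_right (by norm_num) (by omega)
      _ ≤ n + 1 := by omega
  exact ⟨key, Nat.le_log_of_pow_le (by norm_num) key⟩
end

section
/- Under the Move-Half algorithm, let t = 0 or a time at which item v was moved down in Move-Half's tree, and let t' > t be the first time v is requested after time t. If the depth of v in Move-Half's tree at time t' is h, then the depth of v in an MRU tree at time t' is at least ⌊h/2⌋, i.e., ⌊log₂(rank of v at time t')⌋ ≥ ⌊h/2⌋. -/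
theorem itemRank_le_succ {n : ℕ} (r0 : Fin n ≃ Fin n) (σ : ℕ → Fin n) (t : ℕ) {v : Fin n}
    (hv : v ≠ σ t) : itemRank r0 σ t v ≤ itemRank r0 σ (t + 1) v := by
  simp only [itemRank, if_neg hv]
  split_ifs <;> omega

theorem sDepth_lt {K n : ℕ} (hn : n = 2 ^ K - 1) (s : Fin n) : sDepth s < K := by
  have hs := s.isLt
  exact Nat.log_lt_of_lt_pow (Nat.succ_ne_zero _) (by omega)

/-- A full level `e` of the tree holds at least `2 ^ e` items. -/
theorem two_pow_le_card_level {K n e : ℕ} (hn : n = 2 ^ K - 1) (he : e < K)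
    (c : Fin n ≃ Fin n) :
    2 ^ e ≤ (Finset.univ.filter fun x => sDepth (c x) = e).card := by
  have hpow : 2 ^ (e + 1) ≤ 2 ^ K := Nat.pow_le_pow_right two_pos he
  have hpos : 0 < 2 ^ e := by positivity
  rw [pow_succ] at hpow
  let f : Fin (2 ^ e) → Fin n := fun i => c.symm ⟨2 ^ e + i - 1, by omega⟩
  have hf : Function.Injective f := by
    intro i j hij
    have h := congrArg Fin.val (c.symm.injective hij)
    ext
    simp only at h
    omega
  calc 2 ^ e = (Finset.univ.image f).card := by
        rw [Finset.card_image_of_injective _ hf, Finset.card_univ, Fintype.card_fin]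
    _ ≤ _ := by
        refine Finset.card_le_card fun x hx => ?_
        obtain ⟨i, -, rfl⟩ := Finset.mem_image.mp hx
        have hi := i.isLt
        simp only [Finset.mem_filter, Finset.mem_univ, true_and, f, Equiv.apply_symm_apply]
        rw [sDepth, Nat.log_eq_iff (Or.inr ⟨one_lt_two, by omega⟩), pow_succ]
        dsimp only
        omega

/-- An item whose rank is maximal on level `e` has rank at least `2 ^ e`. -/
theorem two_pow_le_itemRank {K n e : ℕ} (hn : n = 2 ^ K - 1) (he : e < K)
    (r0 : Fin n ≃ Fin n) (σ : ℕ → Fin n) (t : ℕ) (c : Fin n ≃ Fin n) {w : Fin n}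
    (hw : ∀ x, sDepth (c x) = e → itemRank r0 σ t x ≤ itemRank r0 σ t w) :
    2 ^ e ≤ itemRank r0 σ t w := by
  refine (two_pow_le_card_level hn he c).trans ?_
  rw [← Finset.card_image_of_injective _ (itemRank_injective r0 σ t)]
  calc _ ≤ (Finset.Icc 1 (itemRank r0 σ t w)).card := by
        refine Finset.card_le_card fun k hk => ?_
        obtain ⟨x, hx, rfl⟩ := Finset.mem_image.mp hk
        exact Finset.mem_Icc.mpr ⟨itemRank_pos r0 σ t x, hw x (Finset.mem_filter.mp hx).2⟩
    _ = itemRank r0 σ t w := by simp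

/-- Under the Move-Half algorithm, let `t = 0`, or let `t` be a time at which item `v`
was (just) moved down in Move-Half's tree, and let `t' > t` be the first time `v` is
requested after time `t`.  If the depth of `v` in Move-Half's tree at time `t'` is `h`,
then the depth of `v` in an MRU tree at time `t'` is at least `⌊h/2⌋`, i.e.
`⌊log₂ (rank of v at time t')⌋ ≥ ⌊h/2⌋`. -/
theorem movehalf_first_request_depth_bound
    (K : ℕ) (hK : 1 ≤ K) (n : ℕ) (hn : n = 2 ^ K - 1)
    (r0 : Fin n ≃ Fin n) (σ : ℕ → Fin n)
    (conf : ℕ → (Fin n ≃ Fin n))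
    (hinit : ∀ v : Fin n, sDepth (conf 0 v) = Nat.log 2 (itemRank r0 σ 0 v))
    (hMH : ∀ t, ∃ v : Fin n,
        sDepth (conf t v) = sDepth (conf t (σ t)) / 2 ∧
        (∀ x : Fin n, sDepth (conf t x) = sDepth (conf t (σ t)) / 2 →
          itemRank r0 σ t x ≤ itemRank r0 σ t v) ∧
        conf (t + 1) = (conf t).trans (Equiv.swap (conf t (σ t)) (conf t v)))
    (v : Fin n) (t t' : ℕ)
    (hmove : t = 0 ∨ sDepth (conf (t - 1) v) < sDepth (conf t v))
    (ht : t < t') (hreq : σ t' = v)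
    (hfirst : ∀ s, t ≤ s → s < t' → σ s ≠ v) :
    sDepth (conf t' v) / 2 ≤ Nat.log 2 (itemRank r0 σ t' v) := by
  have step : ∀ s, (sDepth (conf s v) < sDepth (conf (s + 1) v) ∨
      (σ s ≠ v ∧ sDepth (conf s v) / 2 ≤ Nat.log 2 (itemRank r0 σ s v))) →
      sDepth (conf (s + 1) v) / 2 ≤ Nat.log 2 (itemRank r0 σ (s + 1) v) := by
    intro s hs
    obtain ⟨w, hwd, hwmax, hc⟩ := hMH s
    rw [hc, Equiv.trans_apply] at hs ⊢
    have hv : v ≠ σ s := by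
      rintro rfl
      rw [Equiv.swap_apply_left] at hs
      rcases hs with hs | hs
      · omega
      · exact hs.1 rfl
    have hmono := itemRank_le_succ r0 σ s hv
    by_cases hvw : v = w
    · subst hvw
      rw [Equiv.swap_apply_right]
      have hd := sDepth_lt hn (conf s (σ s))
      exact Nat.le_log_of_pow_le one_lt_two
        ((two_pow_le_itemRank hn (by omega) r0 σ s (conf s) hwmax).trans hmono)
    · rw [Equiv.swap_apply_of_ne_of_ne ((conf s).injective.ne hv)
        ((conf s).injective.ne hvw)] at hs ⊢
      rcases hs with hs | hs
      · exact absurd hs (lt_irrefl _)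
      · exact hs.2.trans (Nat.log_mono_right hmono)
  have base : sDepth (conf t v) / 2 ≤ Nat.log 2 (itemRank r0 σ t v) := by
    cases t with
    | zero =>
      rw [hinit v]
      exact Nat.div_le_self _ _
    | succ s => exact step s (Or.inl (hmove.resolve_left (Nat.succ_ne_zero s)))
  have main : ∀ s, t ≤ s → s ≤ t' →
      sDepth (conf s v) / 2 ≤ Nat.log 2 (itemRank r0 σ s v) := by
    intro s hs
    induction s, hs using Nat.le_induction with
    | base => exact fun _ => base
    | succ s hs ih => exact fun h => step s (Or.inr ⟨hfirst s hs h, ih (by omega)⟩)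
  exact main t' ht.le le_rfl
end
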